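/- Let n ≥ 2 and let F be a subset of the symmetric group S_n such that for any f, g ∈ F there exists x ∈ {1, …, n} with f(x) = g(x). Then |F| = (n−1)! if and only if there exist points i, j ∈ {1, …, n} such that F = { f ∈ S_n : f(i) = j }, i.e., F is a coset of the stabilizer of a point. -/

import Mathlib

section

open Equiv Finset

theorem ck_hit {n : ℕ} (F : Finset (Perm (Fin n)))
    (hF : ∀ f ∈ F, ∀ g ∈ F, ∃ x : Fin n, f x = g x) (hc : F.card * n = n.factorial)
    {ι : Type} [Fintype ι] (hι : Fintype.card ι = n) (L : ι → Perm (Fin n))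
    (hd : ∀ a b, a ≠ b → ∀ i, L a i ≠ L b i) : ∃ a, L a ∈ F := by
  classical
  let φ : F × ι → Perm (Fin n) := fun p => p.1.1 * (L p.2)⁻¹
  have hinj : Function.Injective φ := by
    rintro ⟨⟨f, hf⟩, a⟩ ⟨⟨g, hg⟩, b⟩ h
    simp only [φ] at h
    have hab : a = b := by
      by_contra hab
      obtain ⟨x, hx⟩ := hF f hf g hg
      have h1 : f = (g * (L b)⁻¹) * L a := by rw [← h]; group
      have h2 := congrArg (fun p : Perm (Fin n) => p x) h1
      simp only [Perm.mul_apply, hx] at h2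
      have h3 := g.injective h2
      have h4 : L b x = L a x := by
        conv_lhs => rw [h3]
        simp
      exact hd a b hab x h4.symm
    subst hab
    have : f = g := mul_right_cancel h
    subst this; rfl
  have hbij : Function.Bijective φ := by
    rw [Fintype.bijective_iff_injective_and_card]
    refine ⟨hinj, ?_⟩
    rw [Fintype.card_prod, Fintype.card_coe, hι, hc, Fintype.card_perm, Fintype.card_fin]
  obtain ⟨⟨⟨f, hf⟩, a⟩, h⟩ := hbij.2 1
  refine ⟨a, ?_⟩
  have : f = L a := mul_inv_eq_one.mp h
  exact this ▸ hf

/-- A Latin rectangle which is not full has another row. -/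
theorem ck_extend {n : ℕ} (P : Finset (Perm (Fin n))) (hP : P.card < n)
    (hd : ∀ p ∈ P, ∀ q ∈ P, p ≠ q → ∀ i, p i ≠ q i) :
    ∃ p : Perm (Fin n), ∀ q ∈ P, ∀ i, p i ≠ q i := by
  classical
  let t : Fin n → Finset (Fin n) := fun i => univ \ P.image (fun p => p i)
  have key : ∀ s : Finset (Fin n), s.card ≤ (s.biUnion t).card := by
    intro s
    have := Finset.card_mul_le_card_mul (s := s) (t := s.biUnion t) (m := n - P.card)
      (n := n - P.card) (fun i v => v ∈ t i) ?_ ?_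
    · exact Nat.le_of_mul_le_mul_right this (by omega)
    · intro i hi
      have : (s.biUnion t).bipartiteAbove (fun i v => v ∈ t i) i = t i := by
        ext v
        simp only [bipartiteAbove, mem_filter, mem_biUnion]
        exact ⟨fun h => h.2, fun h => ⟨⟨i, hi, h⟩, h⟩⟩
      rw [this]
      simp only [t]
      rw [card_sdiff_of_subset (subset_univ _), card_univ, Fintype.card_fin]
      have := card_image_le (s := P) (f := fun p => p i)
      omega
    · intro v _
      have hsub : s.bipartiteBelow (fun i v => v ∈ t i) v ⊆
          univ \ P.image (fun p => p⁻¹ v) := by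
        intro i
        simp only [bipartiteBelow, mem_filter, t, mem_sdiff, mem_univ, true_and, mem_image]
        rintro ⟨_, h⟩ ⟨p, hp, hpi⟩
        exact h ⟨p, hp, by rw [← hpi]; simp⟩
      refine (card_le_card hsub).trans ?_
      rw [card_sdiff_of_subset (subset_univ _), card_univ, Fintype.card_fin,
        card_image_of_injOn]
      intro p hp q hq h
      by_contra hpq
      refine hd p hp q hq hpq (p⁻¹ v) ?_
      have h' : p⁻¹ v = q⁻¹ v := h
      conv_rhs => rw [h']
      simp
  obtain ⟨f, hf, hft⟩ := (Finset.all_card_le_biUnion_card_iff_exists_injective t).mp key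
  refine ⟨Equiv.ofBijective f (Finite.injective_iff_bijective.mp hf), ?_⟩
  intro q hq i h
  have := hft i
  simp only [t, mem_sdiff, mem_univ, true_and, mem_image] at this
  exact this ⟨q, hq, h.symm⟩

theorem ck_complete {n : ℕ} (k h : Perm (Fin n)) (hkh : ∀ i, k i ≠ h i) (hn : 2 ≤ n) (r : ℕ)
    (hr : r + 2 ≤ n) :
    ∃ R : Finset (Perm (Fin n)), R.card = r ∧
      (∀ p ∈ R, ∀ q ∈ R, p ≠ q → ∀ i, p i ≠ q i) ∧ ∀ p ∈ R, ∀ i, p i ≠ k i ∧ p i ≠ h i := by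
  classical
  induction r with
  | zero => exact ⟨∅, by simp⟩
  | succ r ih =>
    obtain ⟨R, hRc, hR, hR'⟩ := ih (by omega)
    obtain ⟨p, hp⟩ := ck_extend (insert k (insert h R))
      (by
        have h1 := card_insert_le k (insert h R)
        have h2 := card_insert_le h R
        omega)
      (by
        intro p hp q hq hpq i
        simp only [mem_insert] at hp hq
        have := hkh i
        rcases hp with rfl | rfl | hp <;> rcases hq with rfl | rfl | hq
        · exact absurd rfl hpq
        · exact this
        · exact (hR' q hq i).1.symm
        · exact this.symm
        · exact absurd rfl hpq
        · exact (hR' q hq i).2.symm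
        · exact (hR' p hp i).1
        · exact (hR' p hp i).2
        · exact hR p hp q hq hpq i)
    have i0 : Fin n := ⟨0, by omega⟩
    simp only [mem_insert, forall_eq_or_imp] at hp
    have hpR : p ∉ R := fun hm => hp.2.2 p hm i0 rfl
    refine ⟨insert p R, by rw [card_insert_of_notMem hpR, hRc], ?_, ?_⟩
    · intro a ha b hb hab i
      simp only [mem_insert] at ha hb
      rcases ha with rfl | ha <;> rcases hb with rfl | hb
      · exact absurd rfl hab
      · exact hp.2.2 b hb i
      · exact (hp.2.2 a ha i).symm
      · exact hR a ha b hb hab i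
    · intro a ha i
      simp only [mem_insert] at ha
      rcases ha with rfl | ha
      · exact ⟨hp.1 i, hp.2.1 i⟩
      · exact hR' a ha i

theorem ck_switch {n : ℕ} (hn : 2 ≤ n) (F : Finset (Perm (Fin n)))
    (hF : ∀ f ∈ F, ∀ g ∈ F, ∃ x : Fin n, f x = g x) (hc : F.card * n = n.factorial)
    (k h k' h' : Perm (Fin n)) (hkh : ∀ i, k i ≠ h i)
    (hs : ∀ i, (k' i = k i ∧ h' i = h i) ∨ (k' i = h i ∧ h' i = k i)) (hk : k ∈ F) :
    k' ∈ F ∨ h' ∈ F := by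
  classical
  obtain ⟨R, hRc, hR, hR'⟩ := ck_complete k h hkh hn (n - 2) (by omega)
  have hd' : ∀ i, k' i ≠ h' i := by
    intro i
    have := hkh i
    rcases hs i with ⟨h1, h2⟩ | ⟨h1, h2⟩ <;> rw [h1, h2]
    · exact this
    · exact this.symm
  have hR2 : ∀ p ∈ R, ∀ i, p i ≠ k' i ∧ p i ≠ h' i := by
    intro p hp i
    have := hR' p hp i
    rcases hs i with ⟨h1, h2⟩ | ⟨h1, h2⟩ <;> rw [h1, h2]
    · exact this
    · exact this.symm
  let L : Bool ⊕ R → Perm (Fin n) := Sum.elim (fun b => cond b k' h') (fun p => p.1)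
  obtain ⟨a, ha⟩ := ck_hit F hF hc (ι := Bool ⊕ R)
    (by rw [Fintype.card_sum, Fintype.card_bool, Fintype.card_coe, hRc]; omega) L (by
      rintro (a | ⟨a, ha⟩) (b | ⟨b, hb⟩) hab i
      · cases a <;> cases b
        · exact absurd rfl hab
        · exact (hd' i).symm
        · exact hd' i
        · exact absurd rfl hab
      · cases a
        · exact (hR2 b hb i).2.symm
        · exact (hR2 b hb i).1.symm
      · cases b
        · exact (hR2 a ha i).2
        · exact (hR2 a ha i).1
      · exact hR a ha b hb (fun h => hab (by subst h; rfl)) i)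
  rcases a with a | ⟨a, haR⟩
  · cases a
    · exact Or.inr ha
    · exact Or.inl ha
  · obtain ⟨x, hx⟩ := hF _ ha k hk
    exact absurd hx (hR' a haR x).1

theorem ck_hall {n : ℕ} (hn : 6 ≤ n) (k : Perm (Fin n)) (x y : Fin n) (hx : k x = x)
    (hxy : y ≠ x) : ∃ h : Perm (Fin n), h x = k y ∧ h y = x ∧
      ∀ i, i ≠ x → i ≠ y → h i ≠ i ∧ h i ≠ k i := by
  classical
  have hzx : k y ≠ x := fun h => hxy (k.injective (h.trans hx.symm))
  let ι := {i : Fin n // i ≠ x ∧ i ≠ y}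
  have hι : Fintype.card ι = n - 2 := by
    have h1 : Fintype.card ι = (univ \ {x, y} : Finset (Fin n)).card := by
      rw [Fintype.card_subtype]
      congr 1
      ext i; simp
    rw [h1, card_sdiff_of_subset (subset_univ _), card_univ, Fintype.card_fin,
      card_pair hxy.symm]
  let t : ι → Finset (Fin n) := fun i => univ \ {x, k y, i.1, k i.1}
  have key : ∀ s : Finset ι, s.card ≤ (s.biUnion t).card := by
    intro s
    by_cases h3 : 3 ≤ s.card
    · have hsub : univ \ {x, k y} ⊆ s.biUnion t := by
        intro v hv
        simp only [mem_sdiff, mem_univ, true_and, mem_insert, mem_singleton, not_or] at hv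
        have : ∃ i ∈ s.image Subtype.val, i ∉ ({v, k⁻¹ v} : Finset (Fin n)) := by
          apply exists_mem_notMem_of_card_lt_card
          rw [card_image_of_injective _ Subtype.val_injective]
          have := card_le_two (a := v) (b := k⁻¹ v)
          omega
        obtain ⟨i, hi, hiv⟩ := this
        obtain ⟨j, hj, rfl⟩ := mem_image.mp hi
        simp only [mem_insert, mem_singleton, not_or] at hiv
        refine mem_biUnion.mpr ⟨j, hj, ?_⟩
        simp only [t, mem_sdiff, mem_univ, true_and, mem_insert, mem_singleton, not_or]
        refine ⟨hv.1, hv.2, fun h => hiv.1 h.symm, fun h => hiv.2 ?_⟩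
        rw [h]; simp
      have h1 := card_le_card hsub
      rw [card_sdiff_of_subset (subset_univ _), card_univ, Fintype.card_fin,
        card_pair hzx.symm] at h1
      have h2 := card_le_univ s
      omega
    · rcases s.eq_empty_or_nonempty with rfl | ⟨i, hi⟩
      · simp
      · have h1 := card_le_card (subset_biUnion_of_mem t hi)
        have h2 : n - 4 ≤ (t i).card := by
          simp only [t]
          rw [card_sdiff_of_subset (subset_univ _), card_univ, Fintype.card_fin]
          have := card_le_four (a := x) (b := k y) (c := i.1) (d := k i.1)
          omega
        omega
  obtain ⟨f, hf, hft⟩ := (Finset.all_card_le_biUnion_card_iff_exists_injective t).mp key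
  simp only [t, mem_sdiff, mem_univ, true_and, mem_insert, mem_singleton, not_or] at hft
  let g : Fin n → Fin n := fun i =>
    if h : i ≠ x ∧ i ≠ y then f ⟨i, h⟩ else if i = x then k y else x
  have gx : g x = k y := by simp [g]
  have gy : g y = x := by simp [g, hxy]
  have gi : ∀ i (h : i ≠ x ∧ i ≠ y), g i = f ⟨i, h⟩ := fun i h => by simp [g, h]
  have hg : Function.Injective g := by
    intro a b hab
    by_cases ha : a ≠ x ∧ a ≠ y <;> by_cases hb : b ≠ x ∧ b ≠ y
    · rw [gi a ha, gi b hb] at hab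
      exact congrArg Subtype.val (hf hab)
    · rw [gi a ha] at hab
      have := hft ⟨a, ha⟩
      grind
    · rw [gi b hb] at hab
      have := hft ⟨b, hb⟩
      grind
    · grind
  refine ⟨Equiv.ofBijective g (Finite.injective_iff_bijective.mp hg), gx, gy, ?_⟩
  intro i hi1 hi2
  have := hft ⟨i, hi1, hi2⟩
  rw [Equiv.ofBijective_apply, gi i ⟨hi1, hi2⟩]
  exact ⟨this.2.2.1, this.2.2.2⟩

theorem ck_small3 : ∀ (k : Perm (Fin 3)) (x y w : Fin 3), k x = x → k w = w → w ≠ x → k y ≠ y →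
    ∃ h : Perm (Fin 3), h x = k y ∧ h y = x ∧
      ∀ i, i ≠ x → i ≠ y → h i ≠ i ∧ h i ≠ k i := by decide +kernel

theorem ck_small4 : ∀ (k : Perm (Fin 4)) (x y w : Fin 4), k x = x → k w = w → w ≠ x → k y ≠ y →
    ∃ h : Perm (Fin 4), h x = k y ∧ h y = x ∧
      ∀ i, i ≠ x → i ≠ y → h i ≠ i ∧ h i ≠ k i := by decide +kernel

theorem ck_small5 : ∀ (k : Perm (Fin 5)) (x w : Fin 5), k x = x → k w = w → w ≠ x → ∀ y, k y ≠ y →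
    ∃ h : Perm (Fin 5), h x = k y ∧ h y = x ∧
      ∀ i, i ≠ x → i ≠ y → h i ≠ i ∧ h i ≠ k i := by decide +kernel

def ckL3 (b : Fin 3) : Perm (Fin 3) :=
  ⟨fun i => 2 * i + b, fun i => 2 * (i - b), by decide +revert, by decide +revert⟩

def ckL4 (b : Fin 4) : Perm (Fin 4) :=
  ⟨fun i => (![0, 2, 3, 1] i : Fin 4) ^^^ b, fun i => ![0, 3, 1, 2] (i ^^^ b),
    by decide +revert, by decide +revert⟩

def ckL5 (b : Fin 5) : Perm (Fin 5) :=
  ⟨fun i => 2 * i + b, fun i => 3 * (i - b), by decide +revert, by decide +revert⟩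

theorem ckL3_disj : ∀ a b, a ≠ b → ∀ i, ckL3 a i ≠ ckL3 b i := by decide

theorem ckL3_cyc : ∀ a, (∀ i j, ckL3 a i = i → ckL3 a j = j → i = j) ∧
    ∃ x, ckL3 a x ≠ x ∧ ∀ y, ckL3 a y ≠ y → ∃ i : Fin 3, (ckL3 a ^ i.1) x = y := by decide

theorem ckL4_disj : ∀ a b, a ≠ b → ∀ i, ckL4 a i ≠ ckL4 b i := by decide

theorem ckL4_cyc : ∀ a, (∀ i j, ckL4 a i = i → ckL4 a j = j → i = j) ∧
    ∃ x, ckL4 a x ≠ x ∧ ∀ y, ckL4 a y ≠ y → ∃ i : Fin 4, (ckL4 a ^ i.1) x = y := by decide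

theorem ckL5_disj : ∀ a b, a ≠ b → ∀ i, ckL5 a i ≠ ckL5 b i := by decide

theorem ckL5_cyc : ∀ a, (∀ i j, ckL5 a i = i → ckL5 a j = j → i = j) ∧
    ∃ x, ckL5 a x ≠ x ∧ ∀ y, ckL5 a y ≠ y → ∃ i : Fin 5, (ckL5 a ^ i.1) x = y := by decide

theorem ck_avoid {n : ℕ} (hn : 3 ≤ n) (k : Perm (Fin n)) (x y w : Fin n) (hx : k x = x)
    (hxy : y ≠ x) (hw : k w = w) (hwx : w ≠ x) (hor : 6 ≤ n ∨ k y ≠ y) :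
    ∃ h : Perm (Fin n), h x = k y ∧ h y = x ∧
      ∀ i, i ≠ x → i ≠ y → h i ≠ i ∧ h i ≠ k i := by
  by_cases h6 : 6 ≤ n
  · exact ck_hall h6 k x y hx hxy
  · have hy : k y ≠ y := hor.resolve_left h6
    have : n = 3 ∨ n = 4 ∨ n = 5 := by omega
    rcases this with rfl | rfl | rfl
    · exact ck_small3 k x y w hx hw hwx hy
    · exact ck_small4 k x y w hx hw hwx hy
    · exact ck_small5 k x w hx hw hwx y hy

/-- The fixing operation preserves a maximum family containing the identity. -/
theorem ck_fix {n : ℕ} (hn : 3 ≤ n) (F : Finset (Perm (Fin n)))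
    (hF : ∀ f ∈ F, ∀ g ∈ F, ∃ x : Fin n, f x = g x) (hc : F.card * n = n.factorial)
    (h1 : (1 : Perm (Fin n)) ∈ F) (g : Perm (Fin n)) (hg : g ∈ F) (x : Fin n) (hx : g x ≠ x)
    (hor : 6 ≤ n ∨ g (g x) ≠ x) : swap x (g x) * g ∈ F := by
  obtain ⟨w, hw⟩ := hF g hg 1 h1
  rw [Perm.one_apply] at hw
  have hwx : w ≠ x := fun h => hx (h ▸ hw)
  have hwg : w ≠ g x := fun h => hwx (g.injective (hw.trans h))
  obtain ⟨y, hy⟩ : ∃ y, g y = x := g.surjective x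
  have hyx : y ≠ x := fun h => hx (by rw [h] at hy; exact hy)
  set k := swap x (g x) * g with hk
  have kx : k x = x := by simp [hk]
  have ky : k y = g x := by simp [hk, hy]
  have kw : k w = w := by simp [hk, hw, swap_apply_of_ne_of_ne hwx hwg]
  have ki : ∀ i, i ≠ x → i ≠ y → k i = g i := by
    intro i hi hi'
    rw [hk, Perm.mul_apply]
    exact swap_apply_of_ne_of_ne (fun h => hi' (g.injective (h.trans hy.symm)))
      (fun h => hi (g.injective h))
  obtain ⟨h, hhx, hhy, hh⟩ := ck_avoid hn k x y w kx hyx kw hwx (by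
    rcases hor with h | h
    · exact Or.inl h
    · right
      rw [ky]
      intro h'
      exact h (by rw [h', hy]))
  rw [ky] at hhx
  have hhF : h ∉ F := by
    intro hm
    obtain ⟨i, hi⟩ := hF h hm 1 h1
    rw [Perm.one_apply] at hi
    by_cases hix : i = x
    · subst hix; exact hx (hhx.symm.trans hi)
    by_cases hiy : i = y
    · subst hiy; exact hyx (hi.symm.trans hhy)
    exact (hh i hix hiy).1 hi
  refine (ck_switch (by omega) F hF hc g (h * swap x y) k h ?_ ?_ hg).resolve_right hhF
  · intro i
    rw [Perm.mul_apply]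
    by_cases hix : i = x
    · subst hix; rw [swap_apply_left, hhy]; exact hx
    by_cases hiy : i = y
    · subst hiy; rw [swap_apply_right, hhx, hy]; exact hx.symm
    rw [swap_apply_of_ne_of_ne hix hiy, ← ki i hix hiy]
    exact (hh i hix hiy).2.symm
  · intro i
    rw [Perm.mul_apply h]
    by_cases hix : i = x
    · subst hix; right; rw [swap_apply_left, hhy]; exact ⟨kx, hhx⟩
    by_cases hiy : i = y
    · subst hiy; right; rw [swap_apply_right, hhx, hy]; exact ⟨ky, hhy⟩
    left
    rw [swap_apply_of_ne_of_ne hix hiy, ← ki i hix hiy]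
    exact ⟨rfl, rfl⟩

/-- Common fixed points. -/
theorem ck_common {n : ℕ} (hn : 3 ≤ n) (F : Finset (Perm (Fin n)))
    (hF : ∀ f ∈ F, ∀ g ∈ F, ∃ x : Fin n, f x = g x) (hc : F.card * n = n.factorial)
    (h1 : (1 : Perm (Fin n)) ∈ F) (h : Perm (Fin n)) (hh : h ∈ F) (m : ℕ) :
    ∀ g : Perm (Fin n), g.support.card = m → g ∈ F → (6 ≤ n ∨ g.IsCycle ∨ g = 1) →
      ∃ c, g c = c ∧ h c = c := by
  induction m using Nat.strong_induction_on with
  | _ m ih =>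
    intro g hm hg hor
    obtain ⟨x, hx⟩ := hF g hg h hh
    by_cases hgx : g x = x
    · exact ⟨x, hgx, hx ▸ hgx⟩
    have hlt := Perm.card_support_swap_mul hgx
    have hkF : swap x (g x) * g ∈ F ∧ (6 ≤ n ∨ (swap x (g x) * g).IsCycle ∨
        swap x (g x) * g = 1) := by
      by_cases h6 : 6 ≤ n
      · exact ⟨ck_fix hn F hF hc h1 g hg x hgx (Or.inl h6), Or.inl h6⟩
      · rcases hor with h' | hcyc | rfl
        · exact absurd h' h6
        · by_cases hggx : g (g x) = x
          · have he : swap x (g x) * g = 1 := by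
              have := hcyc.eq_swap_of_apply_apply_eq_self hgx hggx
              conv_lhs => rw [this]
              simp
            rw [he]
            exact ⟨h1, Or.inr (Or.inr rfl)⟩
          · exact ⟨ck_fix hn F hF hc h1 g hg x hgx (Or.inr hggx),
              Or.inr (Or.inl (hcyc.swap_mul hgx hggx))⟩
        · exact absurd rfl hgx
    obtain ⟨c, hc1, hc2⟩ := ih _ (hm ▸ hlt) (swap x (g x) * g) rfl hkF.1 hkF.2
    refine ⟨c, ?_, hc2⟩
    have hcx : c ≠ x := fun h' => hgx (by rw [h', ← hx] at hc2; exact hc2)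
    rw [Perm.mul_apply] at hc1
    by_cases e1 : g c = x
    · rw [e1, swap_apply_left] at hc1
      exact absurd (h.injective (by rw [hc2, ← hx, hc1])) hcx
    · rwa [swap_apply_of_ne_of_ne e1 (fun e => hcx (g.injective e))] at hc1

theorem ck_isCycle {n m : ℕ} {g : Perm (Fin n)}
    (h : ∃ x, g x ≠ x ∧ ∀ y, g y ≠ y → ∃ i : Fin m, (g ^ i.1) x = y) : g.IsCycle := by
  obtain ⟨x, hx, hy⟩ := h
  refine ⟨x, hx, fun y hgy => ?_⟩
  obtain ⟨i, hi⟩ := hy y hgy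
  exact ⟨(i.1 : ℤ), by rw [zpow_natCast]; exact hi⟩

/-- Some member of the family has exactly one fixed point. -/
theorem ck_single {n : ℕ} (hn : 3 ≤ n) (F : Finset (Perm (Fin n)))
    (hF : ∀ f ∈ F, ∀ g ∈ F, ∃ x : Fin n, f x = g x) (hc : F.card * n = n.factorial)
    (h1 : (1 : Perm (Fin n)) ∈ F) (hcard : 1 < F.card) :
    ∃ g ∈ F, (∀ i j, g i = i → g j = j → i = j) ∧ (6 ≤ n ∨ g.IsCycle ∨ g = 1) := by
  by_cases h6 : 6 ≤ n
  · obtain ⟨k, hk, hmax⟩ := exists_max_image F (fun g => g.support.card) ⟨1, h1⟩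
    refine ⟨k, hk, ?_, Or.inl h6⟩
    intro x w hx hw
    by_contra hxw
    have hk1 : ∃ y, k y ≠ y := by
      by_contra hno
      push Not at hno
      have : k = 1 := Equiv.ext hno
      obtain ⟨g, hg, hg1⟩ := exists_mem_ne hcard 1
      have h2 := hmax g hg
      rw [this, Perm.support_one, card_empty, Nat.le_zero, card_eq_zero,
        Perm.support_eq_empty_iff] at h2
      exact hg1 h2
    obtain ⟨y, hy⟩ := hk1
    have hyx : y ≠ x := fun h => hy (by rw [h]; exact hx)
    have hkyx : k y ≠ x := fun h => hyx (k.injective (h.trans hx.symm))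
    have hky : k.support ⊆ univ \ {x, w} := by
      intro i hi
      rw [Perm.mem_support] at hi
      simp only [mem_sdiff, mem_univ, true_and, mem_insert, mem_singleton, not_or]
      exact ⟨fun h => hi (by rw [h]; exact hx), fun h => hi (by rw [h]; exact hw)⟩
    have hkc : k.support.card ≤ n - 2 := by
      have := card_le_card hky
      rwa [card_sdiff_of_subset (subset_univ _), card_univ, Fintype.card_fin,
        card_pair hxw] at this
    obtain ⟨h, hhx, hhy, hh⟩ := ck_hall h6 k x y hx hyx
    have := ck_switch (by omega) F hF hc k h (k * swap x y) (h * swap x y) (by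
        intro i
        by_cases hix : i = x
        · subst hix; rw [hhx, hx]; exact hkyx.symm
        by_cases hiy : i = y
        · subst hiy; rw [hhy]; exact hkyx
        exact (hh i hix hiy).2.symm) (by
        intro i
        rw [Perm.mul_apply, Perm.mul_apply]
        by_cases hix : i = x
        · subst hix; right; rw [swap_apply_left, hhx, hhy, hx]; exact ⟨rfl, rfl⟩
        by_cases hiy : i = y
        · subst hiy; right; rw [swap_apply_right, hhx, hhy, hx]; exact ⟨rfl, rfl⟩
        left
        rw [swap_apply_of_ne_of_ne hix hiy]
        exact ⟨rfl, rfl⟩) hk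
    rcases this with hm | hm
    · have h2 := hmax _ hm
      have h3 : insert x k.support ⊆ (k * swap x y).support := by
        intro i hi
        rw [Perm.mem_support, Perm.mul_apply]
        rw [mem_insert, Perm.mem_support] at hi
        by_cases hix : i = x
        · subst hix; rw [swap_apply_left]; exact hkyx
        by_cases hiy : i = y
        · subst hiy; rw [swap_apply_right, hx]; exact hyx.symm
        rw [swap_apply_of_ne_of_ne hix hiy]
        exact hi.resolve_left hix
      have h4 := card_le_card h3
      rw [card_insert_of_notMem (by rw [Perm.mem_support]; exact fun h => h hx)] at h4
      omega
    · have h2 := hmax _ hm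
      have h3 : univ \ {x} ⊆ (h * swap x y).support := by
        intro i hi
        rw [Perm.mem_support, Perm.mul_apply]
        simp only [mem_sdiff, mem_univ, true_and, mem_singleton] at hi
        by_cases hiy : i = y
        · subst hiy; rw [swap_apply_right, hhx]; exact hy
        rw [swap_apply_of_ne_of_ne hi hiy]
        exact (hh i hi hiy).1
      have h4 := card_le_card h3
      rw [card_sdiff_of_subset (subset_univ _), card_univ, Fintype.card_fin,
        card_singleton] at h4
      omega
  · have : n = 3 ∨ n = 4 ∨ n = 5 := by omega
    rcases this with rfl | rfl | rfl
    · obtain ⟨a, ha⟩ := ck_hit F hF hc (Fintype.card_fin 3) ckL3 ckL3_disj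
      exact ⟨_, ha, (ckL3_cyc a).1, Or.inr (Or.inl (ck_isCycle (ckL3_cyc a).2))⟩
    · obtain ⟨a, ha⟩ := ck_hit F hF hc (Fintype.card_fin 4) ckL4 ckL4_disj
      exact ⟨_, ha, (ckL4_cyc a).1, Or.inr (Or.inl (ck_isCycle (ckL4_cyc a).2))⟩
    · obtain ⟨a, ha⟩ := ck_hit F hF hc (Fintype.card_fin 5) ckL5 ckL5_disj
      exact ⟨_, ha, (ckL5_cyc a).1, Or.inr (Or.inl (ck_isCycle (ckL5_cyc a).2))⟩

theorem ck_coset_card {n : ℕ} (hn : 2 ≤ n) (i j : Fin n) :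
    (univ.filter (fun f : Perm (Fin n) => f i = j)).card = (n - 1).factorial := by
  have heq : ∀ j' : Fin n, (univ.filter (fun f : Perm (Fin n) => f i = j')).card =
      (univ.filter (fun f : Perm (Fin n) => f i = j)).card := by
    intro j'
    refine card_bij' (fun f _ => swap j j' * f) (fun f _ => swap j j' * f) ?_ ?_ ?_ ?_
    · intro f hf
      simp only [mem_filter, mem_univ, true_and] at hf
      simp [hf]
    · intro f hf
      simp only [mem_filter, mem_univ, true_and] at hf
      simp [hf]
    · intro f _; simp
    · intro f _; simp
  have h := card_eq_sum_card_fiberwise (s := (univ : Finset (Perm (Fin n))))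
    (t := (univ : Finset (Fin n))) (f := fun f => f i) (by intro _ _; simp)
  rw [sum_congr rfl (fun j' _ => heq j'), sum_const, card_univ, card_univ, Fintype.card_perm,
    Fintype.card_fin, smul_eq_mul, ← Nat.mul_factorial_pred (by omega : n ≠ 0)] at h
  exact (Nat.eq_of_mul_eq_mul_left (by omega) h).symm

theorem ck_main_one {n : ℕ} (hn : 2 ≤ n) (F : Finset (Perm (Fin n)))
    (hF : ∀ f ∈ F, ∀ g ∈ F, ∃ x : Fin n, f x = g x) (hc : F.card = (n - 1).factorial)
    (h1 : (1 : Perm (Fin n)) ∈ F) :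
    ∃ c : Fin n, F = univ.filter (fun f : Perm (Fin n) => f c = c) := by
  suffices h : ∃ c : Fin n, ∀ f ∈ F, f c = c by
    obtain ⟨c, h⟩ := h
    refine ⟨c, eq_of_subset_of_card_le ?_ ?_⟩
    · intro f hf
      simpa using h f hf
    · rw [ck_coset_card hn, hc]
  by_cases h3 : 3 ≤ n
  · have hc' : F.card * n = n.factorial := by
      rw [hc, mul_comm, Nat.mul_factorial_pred (by omega)]
    have hcard : 1 < F.card := by
      rw [hc]
      have := Nat.self_le_factorial (n - 1)
      omega
    obtain ⟨g, hg, huniq, hor⟩ := ck_single h3 F hF hc' h1 hcard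
    obtain ⟨c, hgc⟩ := hF g hg 1 h1
    refine ⟨c, fun f hf => ?_⟩
    obtain ⟨d, hd1, hd2⟩ := ck_common h3 F hF hc' h1 f hf _ g rfl hg hor
    rw [huniq c d hgc hd1]
    exact hd2
  · have : n = 2 := by omega
    subst this
    obtain ⟨a, ha⟩ := card_eq_one.mp (show F.card = 1 by rw [hc]; rfl)
    refine ⟨0, fun f hf => ?_⟩
    rw [ha, mem_singleton] at hf h1
    rw [hf, ← h1]
    rfl

end

/-- **Cameron–Ku**: for `n ≥ 2`, an intersecting family of permutations of `n` points has
size `(n-1)!` if and only if it is a coset of the stabilizer of a point, i.e.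
`𝓕 = { f : f i = j }` for some points `i, j`. -/
theorem cameron_ku
    (n : ℕ) (hn : 2 ≤ n) (𝓕 : Finset (Equiv.Perm (Fin n)))
    (h𝓕 : ∀ f ∈ 𝓕, ∀ g ∈ 𝓕, ∃ x : Fin n, f x = g x) :
    𝓕.card = Nat.factorial (n - 1) ↔
      ∃ i j : Fin n, 𝓕 = Finset.univ.filter (fun f : Equiv.Perm (Fin n) => f i = j) := by
  classical
  constructor
  · intro hc
    have hne : 𝓕.Nonempty := by
      rw [← Finset.card_pos, hc]
      exact Nat.factorial_pos _
    obtain ⟨g, hg⟩ := hne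
    obtain ⟨c, hF⟩ := ck_main_one hn (𝓕.image (fun f => g⁻¹ * f))
      (by
        intro a ha b hb
        obtain ⟨f, hf, rfl⟩ := Finset.mem_image.mp ha
        obtain ⟨f', hf', rfl⟩ := Finset.mem_image.mp hb
        obtain ⟨x, hx⟩ := h𝓕 f hf f' hf'
        exact ⟨x, by simp [Equiv.Perm.mul_apply, hx]⟩)
      (by rw [Finset.card_image_of_injective _ (mul_right_injective g⁻¹), hc])
      (Finset.mem_image.mpr ⟨g, hg, inv_mul_cancel g⟩)
    refine ⟨c, g c, ?_⟩
    ext f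
    have h := Finset.ext_iff.mp hF (g⁻¹ * f)
    simp only [Finset.mem_image, mul_right_inj, exists_eq_right, Finset.mem_filter,
      Finset.mem_univ, true_and, Equiv.Perm.mul_apply] at h ⊢
    rw [h, Equiv.Perm.inv_eq_iff_eq]
  · rintro ⟨i, j, rfl⟩
    exact ck_coset_card hn i j
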